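/- Let P ⊂ ℝ^3 be a lattice 3-polytope of width 1, i.e., there is a surjective ℤ-linear functional f : ℤ^3 → ℤ (extended linearly to ℝ^3) with f(P) ⊆ [0,1]. Then for every integer k ≥ 2, the dilation kP has a unimodular cover. -/

import Mathlib

open scoped Pointwise

noncomputable section

/-- The real point corresponding to an integer point of `ℤ³`. -/
def toR3 (v : Fin 3 → ℤ) : Fin 3 → ℝ := fun i => (v i : ℝ)

/-- A unimodular tetrahedron: the convex hull of lattice points `v0, v1, v2, v3`
such that `v1 - v0, v2 - v0, v3 - v0` form a `ℤ`-basis of `ℤ³`. -/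
def IsUnimodularTet (S : Set (Fin 3 → ℝ)) : Prop :=
  ∃ v : Fin 4 → Fin 3 → ℤ,
    S = convexHull ℝ {toR3 (v 0), toR3 (v 1), toR3 (v 2), toR3 (v 3)} ∧
    (Matrix.of ![v 1 - v 0, v 2 - v 0, v 3 - v 0]).det ∈ ({1, -1} : Set ℤ)

/-- A unimodular cover of `P`. -/
def HasUnimodularCover (P : Set (Fin 3 → ℝ)) : Prop :=
  ∃ 𝒞 : Set (Set (Fin 3 → ℝ)),
    (∀ S ∈ 𝒞, IsUnimodularTet S ∧ S ⊆ P) ∧ ⋃₀ 𝒞 = P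

def D3 {R : Type*} [CommRing R] (a b c : Fin 3 → R) : R :=
  a 0 * (b 1 * c 2 - b 2 * c 1) - a 1 * (b 0 * c 2 - b 2 * c 0) + a 2 * (b 0 * c 1 - b 1 * c 0)

def D4 {R : Type*} [CommRing R] (v : Fin 4 → Fin 3 → R) : R :=
  D3 (v 1 - v 0) (v 2 - v 0) (v 3 - v 0)

def InTet (v : Fin 4 → Fin 3 → ℤ) (x : Fin 3 → ℝ) : Prop :=
  ∃ t : Fin 4 → ℝ, (∀ i, 0 ≤ t i) ∧ ∑ i, t i = 1 ∧ ∀ j, x j = ∑ i, t i * (v i j : ℝ)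

def Cov (K : Set (Fin 3 → ℝ)) (x : Fin 3 → ℝ) : Prop :=
  ∃ v : Fin 4 → Fin 3 → ℤ, (∀ i, toR3 (v i) ∈ K) ∧ InTet v x ∧ |D4 v| = 1

lemma D3_cast (a b c : Fin 3 → ℤ) : ((D3 a b c : ℤ) : ℝ) = D3 (toR3 a) (toR3 b) (toR3 c) := by
  simp [D3, toR3]

lemma D4_cast (v : Fin 4 → Fin 3 → ℤ) : ((D4 v : ℤ) : ℝ) = D4 (fun i => toR3 (v i)) := by
  simp [D4, D3, toR3]

lemma D4_det (v : Fin 4 → Fin 3 → ℤ) :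
    (Matrix.of ![v 1 - v 0, v 2 - v 0, v 3 - v 0]).det = D4 v := by
  simp [Matrix.det_fin_three, D4, D3]; ring

lemma inTet_hull (v : Fin 4 → Fin 3 → ℤ) (x : Fin 3 → ℝ) (h : InTet v x) :
    x ∈ convexHull ℝ {toR3 (v 0), toR3 (v 1), toR3 (v 2), toR3 (v 3)} := by
  obtain ⟨t, h0, h1, h2⟩ := h
  have : x = ∑ i, t i • toR3 (v i) := by
    ext j; rw [h2 j]; simp [toR3]
  rw [this]
  refine (convex_convexHull ℝ _).sum_mem (fun i _ => h0 i) h1 (fun i _ => subset_convexHull ℝ _ ?_)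
  fin_cases i <;> simp

lemma cover_of_cov (K : Set (Fin 3 → ℝ)) (hK : Convex ℝ K) (h : ∀ x ∈ K, Cov K x) :
    HasUnimodularCover K := by
  refine ⟨{S | IsUnimodularTet S ∧ S ⊆ K}, fun S hS => hS, ?_⟩
  apply Set.Subset.antisymm
  · exact Set.sUnion_subset fun S hS => hS.2
  · intro x hx
    obtain ⟨v, hv, ht, hd⟩ := h x hx
    refine ⟨_, ⟨⟨v, rfl, ?_⟩, ?_⟩, inTet_hull v x ht⟩
    · rw [D4_det]
      rcases abs_eq (by norm_num : (0:ℤ) ≤ 1) |>.1 hd with h | h <;> simp [h]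
    · apply convexHull_min _ hK
      intro y hy
      simp only [Set.mem_insert_iff, Set.mem_singleton_iff] at hy
      rcases hy with rfl | rfl | rfl | rfl <;> apply hv

lemma frac_point (M : Matrix (Fin 3) (Fin 3) ℤ) (h0 : M.det ≠ 0) (h1 : |M.det| ≠ 1) :
    ∃ (l : Fin 3 → ℝ) (z : Fin 3 → ℤ), (∀ i, 0 ≤ l i) ∧ (∀ i, l i < 1) ∧ (∃ i, l i ≠ 0) ∧
      ∀ j, (z j : ℝ) = ∑ i, l i * (M i j : ℝ) := by
  by_cases hd : ∀ i j, M.det ∣ M.adjugate i j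
  · exfalso
    choose N hN using hd
    have h2 : M.adjugate = M.det • (Matrix.of N) := by
      ext i j; simp [hN]
    have h3 := Matrix.adjugate_mul M
    rw [h2, Matrix.smul_mul] at h3
    have h4 : Matrix.of N * M = 1 := by
      have := smul_right_injective (Matrix (Fin 3) (Fin 3) ℤ) h0
      exact this h3
    have h5 := congrArg Matrix.det h4
    rw [Matrix.det_mul, Matrix.det_one] at h5
    exact h1 (Int.isUnit_iff_abs_eq.1 (IsUnit.of_mul_eq_one_right _ h5))
  · push Not at hd
    obtain ⟨i, j, hij⟩ := hd
    have hadj := Matrix.adjugate_mul M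
    generalize M.det = d at *
    generalize M.adjugate = A at *
    have hD : (d : ℝ) ≠ 0 := by exact_mod_cast h0
    refine ⟨fun j => Int.fract ((A i j : ℝ) / d),
      fun j' => (if i = j' then 1 else 0) - ∑ j, ⌊(A i j : ℝ) / d⌋ * M j j', fun _ => Int.fract_nonneg _,
      fun _ => Int.fract_lt_one _, ⟨j, ?_⟩, ?_⟩
    · intro h
      apply hij
      simp only [Int.fract, sub_eq_zero] at h
      refine ⟨⌊(A i j : ℝ) / d⌋, ?_⟩
      rw [div_eq_iff hD] at h
      have : ((A i j : ℤ) : ℝ) = ((d * ⌊(A i j : ℝ) / d⌋ : ℤ) : ℝ) := by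
        push_cast; linarith
      exact_mod_cast this
    · intro j'
      have h3 := congrFun (congrFun hadj i) j'
      simp only [Matrix.mul_apply, Matrix.smul_apply, Matrix.one_apply, Fin.sum_univ_three, smul_eq_mul] at h3
      have h4 : (A i 0 : ℝ) * M 0 j' + A i 1 * M 1 j' + A i 2 * M 2 j' = d * (if i = j' then 1 else 0 : ℤ) := by
        exact_mod_cast h3
      simp only [Int.fract, Fin.sum_univ_three]
      push_cast at h4 ⊢
      field_simp
      linear_combination -h4

lemma frac3 (a b c : Fin 3 → ℤ) (h0 : D3 a b c ≠ 0) (h1 : |D3 a b c| ≠ 1) :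
    ∃ (l : Fin 3 → ℝ) (z : Fin 3 → ℤ), (∀ i, 0 ≤ l i) ∧ (∀ i, l i < 1) ∧ (∃ i, l i ≠ 0) ∧
      ∀ j, (z j : ℝ) = l 0 * a j + l 1 * b j + l 2 * c j := by
  have : (Matrix.of ![a, b, c]).det = D3 a b c := by
    simp [Matrix.det_fin_three, D3]; ring
  obtain ⟨l, z, h⟩ := frac_point (Matrix.of ![a, b, c]) (by rwa [this]) (by rwa [this])
  refine ⟨l, z, h.1, h.2.1, h.2.2.1, fun j => ?_⟩
  rw [h.2.2.2 j]; simp [Fin.sum_univ_three]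

/-- minimal tetrahedra in a family -/
def IsMinTet (Q : (Fin 4 → Fin 3 → ℤ) → Prop) (x : Fin 3 → ℝ) (v : Fin 4 → Fin 3 → ℤ) : Prop :=
  Q v ∧ InTet v x ∧ D4 v ≠ 0 ∧ ∀ v', Q v' → InTet v' x → D4 v' ≠ 0 → |D4 v| ≤ |D4 v'|

lemma exists_min (Q : (Fin 4 → Fin 3 → ℤ) → Prop) (x : Fin 3 → ℝ) (v : Fin 4 → Fin 3 → ℤ)
    (h1 : Q v) (h2 : InTet v x) (h3 : D4 v ≠ 0) : ∃ v', IsMinTet Q x v' := by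
  classical
  have hex : ∃ n : ℕ, ∃ v, Q v ∧ InTet v x ∧ D4 v ≠ 0 ∧ (D4 v).natAbs = n := ⟨_, v, h1, h2, h3, rfl⟩
  obtain ⟨v', a, b, c, d⟩ := Nat.find_spec hex
  refine ⟨v', a, b, c, fun v'' a' b' c' => ?_⟩
  have := Nat.find_min' hex ⟨v'', a', b', c', rfl⟩
  rw [← d] at this
  rw [Int.abs_eq_natAbs, Int.abs_eq_natAbs]; exact_mod_cast this

lemma D4_update (v : Fin 4 → Fin 3 → ℝ) (z : Fin 3 → ℝ) (l : Fin 4 → ℝ) (hl : ∑ i, l i = 1)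
    (hz : ∀ j, z j = ∑ i, l i * v i j) (i : Fin 4) : D4 (Function.update v i z) = l i * D4 v := by
  simp only [Fin.sum_univ_four] at hl hz
  have h0 : l 0 = 1 - l 1 - l 2 - l 3 := by linarith
  fin_cases i <;> simp [D4, D3, Function.update, hz, h0] <;> ring

lemma empty_of_min (Q : (Fin 4 → Fin 3 → ℤ) → Prop) (x : Fin 3 → ℝ) (v : Fin 4 → Fin 3 → ℤ)
    (hm : IsMinTet Q x v) (l : Fin 4 → ℝ) (z : Fin 3 → ℤ) (h0 : ∀ i, 0 ≤ l i) (h1 : ∑ i, l i = 1)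
    (hz : ∀ j, (z j : ℝ) = ∑ i, l i * (v i j : ℝ))
    (hQ : ∀ i, 0 < l i → Q (Function.update v i z)) : ∃ i, l i = 1 := by
  classical
  by_contra hne
  push Not at hne
  have hle : ∀ i, l i < 1 := by
    intro i
    refine lt_of_le_of_ne ?_ (hne i)
    rw [← h1]
    exact Finset.single_le_sum (fun i _ => h0 i) (Finset.mem_univ i)
  obtain ⟨hv, ⟨t, t0, t1, t2⟩, hd, hmin⟩ := hm
  have hne : (Finset.univ.filter (fun i => 0 < l i)).Nonempty := by
    by_contra hcon
    rw [Finset.not_nonempty_iff_eq_empty, Finset.filter_eq_empty_iff] at hcon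
    have : ∑ i, l i = 0 := Finset.sum_eq_zero fun i hi => le_antisymm (not_lt.1 (hcon hi)) (h0 i)
    linarith
  obtain ⟨i, hi, him⟩ := Finset.exists_min_image _ (fun i => t i / l i) hne
  simp only [Finset.mem_filter, Finset.mem_univ, true_and] at hi him
  have hD : ((D4 (Function.update v i z) : ℤ) : ℝ) = l i * D4 v := by
    rw [D4_cast, D4_cast, ← D4_update _ (toR3 z) l h1 (by simpa [toR3] using hz)]
    congr 1
    ext k j
    by_cases hk : k = i
    · subst hk; simp
    · simp [Function.update, hk]
  have hd' : ((D4 v : ℤ) : ℝ) ≠ 0 := by exact_mod_cast hd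
  have := hmin (Function.update v i z) (hQ i hi) ?_ ?_
  · have h' : |((D4 v : ℤ) : ℝ)| ≤ |((D4 (Function.update v i z) : ℤ) : ℝ)| := by exact_mod_cast this
    rw [hD, abs_mul, abs_of_pos hi] at h'
    have := abs_pos.2 hd'
    nlinarith [hle i]
  · set r := t i / l i with hr
    have hri : r * l i = t i := by rw [hr]; field_simp
    have hr0 : 0 ≤ r := div_nonneg (t0 i) (h0 i)
    have key : ∀ y : Fin 4 → ℝ, ∀ w : ℝ, w = ∑ k, l k * y k →
        ∑ k, (Function.update (fun k => t k - r * l k) i r) k * (Function.update y i w) k = ∑ k, t k * y k := by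
      intro y w hw
      have e1 : ∀ k, (Function.update (fun k => t k - r * l k) i r) k * (Function.update y i w) k
          = (t k * y k - r * (l k * y k)) + if k = i then r * w else 0 := by
        intro k
        by_cases hk : k = i
        · subst hk; clear_value r; simp; linear_combination -y k * hri
        · simp [Function.update, hk]; ring
      rw [Finset.sum_congr rfl (fun k _ => e1 k), Finset.sum_add_distrib, Finset.sum_sub_distrib, ← Finset.mul_sum, ← hw]
      simp
    refine ⟨Function.update (fun k => t k - r * l k) i r, ?_, ?_, ?_⟩
    · intro k
      by_cases hk : k = i
      · subst hk; simpa using hr0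
      · simp only [Function.update, hk, dite_false]
        rcases (h0 k).eq_or_lt with h | h
        · rw [← h]; simpa using t0 k
        · have := him k h
          rw [le_div_iff₀ h] at this
          linarith
    · have := key (fun _ => 1) 1 (by simpa using h1.symm)
      simpa [Function.update, t1] using this
    · intro j
      rw [t2 j, ← key (fun k => (v k j : ℝ)) (z j) (hz j)]
      refine Finset.sum_congr rfl fun k _ => ?_
      by_cases hk : k = i
      · subst hk; simp
      · simp [Function.update, hk]
  · intro h
    rw [h] at hD
    have : l i * ((D4 v : ℤ) : ℝ) ≠ 0 := mul_ne_zero hi.ne' hd'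
    apply this; rw [← hD]; simp


lemma mem_of_comb {K : Set (Fin 3 → ℝ)} (hK : Convex ℝ K) (v : Fin 4 → Fin 3 → ℤ)
    (hv : ∀ i, toR3 (v i) ∈ K) (x : Fin 3 → ℝ) (h : InTet v x) : x ∈ K := by
  obtain ⟨t, h0, h1, h2⟩ := h
  have : x = ∑ i, t i • toR3 (v i) := by
    ext j; rw [h2 j]; simp [toR3]
  rw [this]
  exact hK.sum_mem (fun i _ => h0 i) h1 (fun i _ => hv i)

lemma f_comb (f : (Fin 3 → ℝ) →ₗ[ℝ] ℝ) (v : Fin 4 → Fin 3 → ℤ) (t : Fin 4 → ℝ) (x : Fin 3 → ℝ)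
    (h : ∀ j, x j = ∑ i, t i * (v i j : ℝ)) : f x = ∑ i, t i * f (toR3 (v i)) := by
  have : x = ∑ i, t i • toR3 (v i) := by
    ext j; rw [h j]; simp [toR3]
  rw [this]; simp

lemma int_zero {n : ℤ} {l s : ℝ} (h0 : 0 ≤ l) (h1 : l < 1) (hs : |s| = 1) (h : l * s = n) : l = 0 := by
  have h2 : |(n : ℝ)| = l := by rw [← h, abs_mul, hs, abs_of_nonneg h0, mul_one]
  have h3 : |n| < 1 := by
    have : |(n : ℝ)| < 1 := by rw [h2]; exact h1
    exact_mod_cast this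
  rw [Int.abs_lt_one_iff] at h3
  rw [← h2, h3]; simp

lemma cov_13 (K : Set (Fin 3 → ℝ)) (hK : Convex ℝ K) (f : (Fin 3 → ℝ) →ₗ[ℝ] ℝ)
    (hfint : ∀ z : Fin 3 → ℤ, ∃ n : ℤ, f (toR3 z) = n) (x : Fin 3 → ℝ)
    (v : Fin 4 → Fin 3 → ℤ) (hv : ∀ i, toR3 (v i) ∈ K) (hd : D4 v ≠ 0) (ht : InTet v x)
    (h1 : f (toR3 (v 1)) = f (toR3 (v 0))) (h2 : f (toR3 (v 2)) = f (toR3 (v 0)))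
    (h3 : |f (toR3 (v 3)) - f (toR3 (v 0))| = 1) : Cov K x := by
  set p := f (toR3 (v 0)) with hp
  set r := f (toR3 (v 3)) with hr
  obtain ⟨u, hmin⟩ := exists_min (fun v' => (∀ i, toR3 (v' i) ∈ K) ∧ f (toR3 (v' 0)) = p ∧
    f (toR3 (v' 1)) = p ∧ f (toR3 (v' 2)) = p ∧ f (toR3 (v' 3)) = r) x v ⟨hv, rfl, h1, h2, rfl⟩ ht hd
  obtain ⟨⟨uK, u0, u1, u2, u3⟩, ut, ud, -⟩ := id hmin
  refine ⟨u, uK, ut, ?_⟩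
  by_contra hD
  have key : ∀ (a b : ℝ) (z : Fin 3 → ℤ), 0 ≤ a → 0 ≤ b → a + b ≤ 1 →
      (∀ j, (z j : ℝ) = (1 - a - b) * u 0 j + a * u 1 j + b * u 2 j) →
      (a = 0 ∧ b = 0) ∨ a = 1 ∨ b = 1 := by
    intro a b z ha hb hab hz
    have l0 : ∀ i, 0 ≤ (![1 - a - b, a, b, 0] : Fin 4 → ℝ) i := by
      intro i; fin_cases i <;> simp <;> linarith
    have l1 : ∑ i, (![1 - a - b, a, b, 0] : Fin 4 → ℝ) i = 1 := by
      simp [Fin.sum_univ_four]; ring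
    have hz' : ∀ j, (z j : ℝ) = ∑ i, (![1 - a - b, a, b, 0] : Fin 4 → ℝ) i * (u i j : ℝ) := by
      intro j; rw [hz j]; simp [Fin.sum_univ_four]
    have zK : toR3 z ∈ K := mem_of_comb hK u uK _ ⟨_, l0, l1, hz'⟩
    have zf : f (toR3 z) = p := by
      rw [f_comb f u _ (toR3 z) hz']
      simp [Fin.sum_univ_four, u0, u1, u2]; ring
    obtain ⟨i, hi⟩ := empty_of_min _ x u hmin _ z l0 l1 hz' (by
      intro i hi
      refine ⟨?_, ?_⟩
      · intro k
        by_cases hk : k = i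
        · subst hk; simpa using zK
        · simpa [Function.update, hk] using uK k
      · fin_cases i <;> simp_all [Function.update])
    fin_cases i <;> simp at hi
    · left; constructor <;> linarith
    · exact Or.inr (Or.inl hi)
    · exact Or.inr (Or.inr hi)
  obtain ⟨l, z, l0, l1, ⟨i, hi⟩, hz⟩ := frac3 _ _ _ ud hD
  have hl2 : l 2 = 0 := by
    obtain ⟨n, hn⟩ := hfint z
    have e : toR3 z = l 0 • (toR3 (u 1) - toR3 (u 0)) + l 1 • (toR3 (u 2) - toR3 (u 0)) + l 2 • (toR3 (u 3) - toR3 (u 0)) := by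
      ext j; have := hz j; simp [toR3] at this ⊢; exact this
    rw [e] at hn
    simp [u0, u1, u2, u3] at hn
    exact int_zero (l0 2) (l1 2) h3 hn
  have a0 := l0 0
  have a1 := l0 1
  have b0 := l1 0
  have b1 := l1 1
  rcases le_total (l 0 + l 1) 1 with h | h
  · rcases key (l 0) (l 1) (z + u 0) a0 a1 h (by
      intro j; have := hz j; simp [hl2] at this ⊢; linarith) with ⟨c, d⟩ | c | c
    · fin_cases i <;> simp_all
    · linarith
    · linarith
  · rcases key (1 - l 0) (1 - l 1) (u 1 + u 2 - u 0 - z) (by linarith) (by linarith) (by linarith) (by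
      intro j; have := hz j; simp [hl2] at this ⊢; linarith) with ⟨c, d⟩ | c | c <;> linarith

/-- integer cell -/
lemma cell (n : ℕ) (hn : 1 ≤ n) (y : ℝ) (h0 : 0 ≤ y) (h1 : y ≤ n) :
    ∃ i : ℤ, 0 ≤ i ∧ i + 1 ≤ n ∧ (i : ℝ) ≤ y ∧ y ≤ i + 1 := by
  rcases lt_or_ge y n with h | h
  · refine ⟨⌊y⌋, Int.floor_nonneg.2 h0, ?_, Int.floor_le y, (Int.lt_floor_add_one y).le⟩
    have : ⌊y⌋ < n := Int.floor_lt.2 (by exact_mod_cast h)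
    omega
  · refine ⟨n - 1, by omega, by omega, ?_, ?_⟩ <;> push_cast <;> linarith

lemma cov_cone (K : Set (Fin 3 → ℝ)) (hK : Convex ℝ K) (f : (Fin 3 → ℝ) →ₗ[ℝ] ℝ)
    (hfint : ∀ z : Fin 3 → ℤ, ∃ n : ℤ, f (toR3 z) = n) (x : Fin 3 → ℝ)
    (u w A B : Fin 3 → ℤ) (fu : f (toR3 u) = 0) (fw : f (toR3 w) = 0)
    (hf : |f (toR3 A) - f (toR3 B)| = 1) (hd : D3 u w (A - B) ≠ 0)
    (a b : ℕ) (ha : 1 ≤ a) (hb : 1 ≤ b) (hA : toR3 A ∈ K)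
    (hB : ∀ i l : ℤ, 0 ≤ i → i ≤ a → 0 ≤ l → l ≤ b → toR3 (B + i • u + l • w) ∈ K)
    (h α β : ℝ) (h0 : 0 ≤ h) (h1 : h ≤ 1) (α0 : 0 ≤ α) (α1 : α ≤ a) (β0 : 0 ≤ β) (β1 : β ≤ b)
    (hx : ∀ j, x j = (1 - h) * A j + h * (B j + α * u j + β * w j)) : Cov K x := by
  obtain ⟨i, i0, i1, i2, i3⟩ := cell a ha α α0 α1
  obtain ⟨l, l0, l1, l2, l3⟩ := cell b hb β β0 β1
  have ff : ∀ i l : ℤ, f (toR3 (B + i • u + l • w)) = f (toR3 B) := by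
    intro i l
    have : toR3 (B + i • u + l • w) = toR3 B + (i : ℝ) • toR3 u + (l : ℝ) • toR3 w := by
      ext j; simp [toR3]
    rw [this]; simp [fu, fw]
  rcases le_total ((α - i) + (β - l)) 1 with hs | hs
  · refine cov_13 K hK f hfint x ![B + i • u + l • w, B + (i+1) • u + l • w, B + i • u + (l+1) • w, A]
      ?_ ?_ ⟨![h * (1 - (α - i) - (β - l)), h * (α - i), h * (β - l), 1 - h], ?_, ?_, ?_⟩ ?_ ?_ ?_
    · intro k
      fin_cases k
      · exact hB _ _ (by omega) (by omega) (by omega) (by omega)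
      · exact hB _ _ (by omega) (by omega) (by omega) (by omega)
      · exact hB _ _ (by omega) (by omega) (by omega) (by omega)
      · exact hA
    · convert! hd using 1
      simp [D4, D3]; ring
    · intro k
      fin_cases k
      · exact mul_nonneg h0 (by linarith)
      · exact mul_nonneg h0 (by linarith)
      · exact mul_nonneg h0 (by linarith)
      · simpa using h1
    · simp [Fin.sum_univ_four]; ring
    · intro j; rw [hx j]; simp [Fin.sum_univ_four]; ring
    · simp only [Matrix.cons_val]; rw [ff, ff]
    · simp only [Matrix.cons_val]; rw [ff, ff]
    · simp only [Matrix.cons_val]; rw [ff]; exact hf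
  · refine cov_13 K hK f hfint x ![B + (i+1) • u + (l+1) • w, B + i • u + (l+1) • w, B + (i+1) • u + l • w, A]
      ?_ ?_ ⟨![h * ((α - i) + (β - l) - 1), h * (1 - (α - i)), h * (1 - (β - l)), 1 - h], ?_, ?_, ?_⟩ ?_ ?_ ?_
    · intro k
      fin_cases k
      · exact hB _ _ (by omega) (by omega) (by omega) (by omega)
      · exact hB _ _ (by omega) (by omega) (by omega) (by omega)
      · exact hB _ _ (by omega) (by omega) (by omega) (by omega)
      · exact hA
    · convert! hd using 1
      simp [D4, D3]; ring
    · intro k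
      fin_cases k
      · exact mul_nonneg h0 (by linarith)
      · exact mul_nonneg h0 (by linarith)
      · exact mul_nonneg h0 (by linarith)
      · simpa using h1
    · simp [Fin.sum_univ_four]; ring
    · intro j; rw [hx j]; simp [Fin.sum_univ_four]; ring
    · simp only [Matrix.cons_val]; rw [ff, ff]
    · simp only [Matrix.cons_val]; rw [ff, ff]
    · simp only [Matrix.cons_val]; rw [ff]; exact hf

lemma exists_g (f : (Fin 3 → ℝ) →ₗ[ℝ] ℝ)
    (hfint : ∀ z : Fin 3 → ℤ, ∃ n : ℤ, f (toR3 z) = n)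
    (u w c : Fin 3 → ℤ) (fu : f (toR3 u) = 0) (fw : f (toR3 w) = 0)
    (fc : |f (toR3 c)| = 1) (hd : D3 u w c ≠ 0)
    (hprim : ∀ (l : ℝ) (z : Fin 3 → ℤ), 0 ≤ l → l < 1 → (∀ j, (z j : ℝ) = l * u j) → l = 0) :
    ∃ (g : Fin 3 → ℤ) (m q : ℤ), |D3 u g c| = 1 ∧ 0 < q ∧ ∀ j, w j = m * u j + q * g j := by
  classical
  have hex : ∃ n : ℕ, ∃ g, f (toR3 g) = 0 ∧ D3 u g c ≠ 0 ∧ (D3 u g c).natAbs = n := ⟨_, w, fw, hd, rfl⟩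
  obtain ⟨g, fg, gd, gn⟩ := Nat.find_spec hex
  have hg1 : |D3 u g c| = 1 := by
    by_contra hD
    obtain ⟨l, z, l0, l1, ⟨i, hi⟩, hz⟩ := frac3 _ _ _ gd hD
    have e : toR3 z = l 0 • toR3 u + l 1 • toR3 g + l 2 • toR3 c := by
      ext j; have := hz j; simpa [toR3] using this
    have fz : f (toR3 z) = l 2 * f (toR3 c) := by
      rw [e]; simp [fu, fg]
    have hl2 : l 2 = 0 := by
      obtain ⟨n, hn⟩ := hfint z
      rw [fz] at hn
      exact int_zero (l0 2) (l1 2) fc hn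
    by_cases hl1 : l 1 = 0
    · have := hprim (l 0) z (l0 0) (l1 0) (by intro j; rw [hz j, hl1, hl2]; ring)
      fin_cases i <;> simp_all
    · have hpos : 0 < l 1 := lt_of_le_of_ne (l0 1) (Ne.symm hl1)
      have hDz : ((D3 u z c : ℤ) : ℝ) = l 1 * ((D3 u g c : ℤ) : ℝ) := by
        rw [D3_cast, D3_cast]
        simp only [D3, toR3]
        rw [hz 0, hz 1, hz 2, hl2]; ring
      have gd' : ((D3 u g c : ℤ) : ℝ) ≠ 0 := by exact_mod_cast gd
      have := Nat.find_min' hex ⟨z, by rw [fz, hl2, zero_mul], ?_, rfl⟩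
      · rw [← gn] at this
        have h' : |D3 u g c| ≤ |D3 u z c| := by
          rw [Int.abs_eq_natAbs, Int.abs_eq_natAbs]; exact_mod_cast this
        have h' : |((D3 u g c : ℤ) : ℝ)| ≤ |((D3 u z c : ℤ) : ℝ)| := by exact_mod_cast h'
        rw [hDz, abs_mul, abs_of_pos hpos] at h'
        have := abs_pos.2 gd'
        nlinarith [l1 1]
      · intro h
        rw [h] at hDz
        exact mul_ne_zero hpos.ne' gd' (by rw [← hDz]; simp)
  have cram : ∀ j, D3 u g c * w j = D3 w g c * u j + D3 u w c * g j + D3 u g w * c j := by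
    intro j; fin_cases j <;> simp [D3] <;> ring
  have h3 : D3 u g w = 0 := by
    have e : ((D3 u g c : ℤ) : ℝ) • toR3 w = ((D3 w g c : ℤ) : ℝ) • toR3 u + ((D3 u w c : ℤ) : ℝ) • toR3 g + ((D3 u g w : ℤ) : ℝ) • toR3 c := by
      ext j
      have := cram j
      simp only [toR3, Pi.add_apply, Pi.smul_apply, smul_eq_mul]
      exact_mod_cast this
    have := congrArg f e
    simp only [map_add, map_smul, fw, fu, fg, smul_eq_mul, mul_zero, zero_add] at this
    have hc : f (toR3 c) ≠ 0 := by intro h; rw [h] at fc; simp at fc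
    rcases mul_eq_zero.1 this.symm with h | h
    · exact_mod_cast h
    · exact absurd h hc
  rcases abs_eq (by norm_num : (0:ℤ) ≤ 1) |>.1 hg1 with h | h <;> rw [h3, h] at cram <;>
    rcases lt_or_gt_of_ne hd with hq | hq
  · refine ⟨-g, D3 w g c, -D3 u w c, ?_, by omega, fun j => ?_⟩
    · rw [← hg1, ← abs_neg]; congr 1; simp [D3]; ring
    · have := cram j; simp; linarith
  · refine ⟨g, D3 w g c, D3 u w c, hg1, by omega, fun j => ?_⟩
    have := cram j; linarith
  · refine ⟨g, -D3 w g c, -D3 u w c, hg1, by omega, fun j => ?_⟩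
    have := cram j; linarith
  · refine ⟨-g, -D3 w g c, D3 u w c, ?_, by omega, fun j => ?_⟩
    · rw [← hg1, ← abs_neg]; congr 1; simp [D3]; ring
    · have := cram j; simp; linarith


lemma pick_row (b : ℕ) (h β : ℝ) (β0 : 0 ≤ β)
    (hb : b = 0 ∨ 1 ≤ h * (b + 2)) (n : ℕ) (hn : n ≤ b) (hβ : β ≤ (1 - h) * n + h * (b + 1)) :
    ∃ i : ℕ, i ≤ n ∧ (1 - h) * i ≤ β ∧ β ≤ (1 - h) * i + h * (b + 1) := by
  induction n with
  | zero => exact ⟨0, le_rfl, by simpa using β0, hβ⟩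
  | succ n ih =>
    by_cases hc : (1 - h) * ((n + 1 : ℕ) : ℝ) ≤ β
    · exact ⟨n + 1, le_rfl, hc, hβ⟩
    · push Not at hc
      have hb' : 1 ≤ h * (b + 2) := by
        rcases hb with h | h
        · omega
        · exact h
      obtain ⟨i, hi, h'⟩ := ih (by omega) (by push_cast at hc; nlinarith)
      exact ⟨i, by omega, h'⟩

set_option maxHeartbeats 1000000 in
lemma cov_B (K : Set (Fin 3 → ℝ)) (hK : Convex ℝ K) (f : (Fin 3 → ℝ) →ₗ[ℝ] ℝ)
    (hfint : ∀ z : Fin 3 → ℤ, ∃ n : ℤ, f (toR3 z) = n) (x : Fin 3 → ℝ)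
    (v0 u v2 w : Fin 3 → ℤ) (fu : f (toR3 u) = 0) (fw : f (toR3 w) = 0)
    (fc : |f (toR3 (v2 - v0))| = 1) (hd : D3 u w (v2 - v0) ≠ 0)
    (hprim : ∀ (l : ℝ) (z : Fin 3 → ℤ), 0 ≤ l → l < 1 → (∀ j, (z j : ℝ) = l * u j) → l = 0)
    (k a b : ℕ) (ha : 1 ≤ a) (hk : a + b + 1 = k)
    (hKm : ∀ s0 s2 α β : ℝ, s0 + s2 = k → 0 ≤ α → α ≤ s0 → 0 ≤ β → β ≤ s2 → ∀ y : Fin 3 → ℝ,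
      (∀ j, y j = s0 * v0 j + s2 * v2 j + α * u j + β * w j) → y ∈ K)
    (h α β : ℝ) (h0 : 0 ≤ h) (h1 : h ≤ 1) (α0 : 0 ≤ α) (α1 : α ≤ a + 1 - h) (β0 : 0 ≤ β)
    (β1 : β ≤ b + h) (hb : b = 0 ∨ 1 ≤ h * (b + 2))
    (hx : ∀ j, x j = (a + 1 - h) * v0 j + (b + h) * v2 j + α * u j + β * w j) : Cov K x := by
  obtain ⟨g, m, q, hg, hq, hw⟩ := exists_g f hfint u w (v2 - v0) fu fw fc hd hprim
  have hkR : (a : ℝ) + b + 1 = k := by exact_mod_cast hk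
  have haR : (1 : ℝ) ≤ a := by exact_mod_cast ha
  have hbR : (0 : ℝ) ≤ b := by positivity
  have hqR : (0 : ℝ) < q := by exact_mod_cast hq
  have hwR : ∀ j, (w j : ℝ) = m * u j + q * g j := by intro j; exact_mod_cast hw j
  obtain ⟨i, hi, i1, i2⟩ := pick_row b h β β0 hb b le_rfl (by linarith)
  have hiR : (i : ℝ) ≤ b := by exact_mod_cast hi
  have hiR0 : (0 : ℝ) ≤ i := by positivity
  -- the coordinate at the upper level
  obtain ⟨B1, B10, B11, B1e⟩ : ∃ B1 : ℝ, 0 ≤ B1 ∧ B1 ≤ b + 1 ∧ h * B1 = β - (1 - h) * i := by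
    rcases h0.eq_or_lt with hz | hz
    · refine ⟨0, le_rfl, by linarith, ?_⟩
      rw [← hz] at i1 i2 ⊢; linarith
    · refine ⟨(β - (1 - h) * i) / h, div_nonneg (by linarith) h0, ?_, by field_simp⟩
      rw [div_le_iff₀ hz]; linarith
  have hden : 0 < (a : ℝ) + 1 - h := by linarith
  obtain ⟨A0, A1, A00, A01, A10, A11, Ae⟩ : ∃ A0 A1 : ℝ, 0 ≤ A0 ∧ A0 ≤ a + 1 ∧ 0 ≤ A1 ∧ A1 ≤ a ∧
      (1 - h) * A0 + h * A1 = α := by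
    refine ⟨α / (a + 1 - h) * (a + 1), α / (a + 1 - h) * a, ?_, ?_, ?_, ?_, ?_⟩
    · positivity
    · have : α / (a + 1 - h) ≤ 1 := by rw [div_le_one hden]; exact α1
      nlinarith
    · positivity
    · have : α / (a + 1 - h) ≤ 1 := by rw [div_le_one hden]; exact α1
      nlinarith
    · field_simp; ring
  obtain ⟨n, n0, n1, n2, n3⟩ := cell (a + 1) (by omega) A0 A00 (by exact_mod_cast A01)
  have n0R : (0 : ℝ) ≤ n := by exact_mod_cast n0
  have n1R : (n : ℝ) + 1 ≤ a + 1 := by exact_mod_cast n1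
  obtain ⟨r, r0, r1, r2, r3⟩ := cell (q.toNat * (b + 1))
    (Nat.succ_le_of_lt (Nat.mul_pos (by omega) (by omega))) (q * B1) (by positivity) (by
      have : ((q.toNat : ℕ) : ℝ) = q := by
        have : ((q.toNat : ℕ) : ℤ) = q := Int.toNat_of_nonneg hq.le
        exact_mod_cast this
      push_cast; rw [this]; gcongr)
  have r0R : (0 : ℝ) ≤ r := by exact_mod_cast r0
  have r1R : (r : ℝ) + 1 ≤ q * (b + 1) := by
    have e : ((q.toNat : ℕ) : ℤ) = q := Int.toNat_of_nonneg hq.le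
    push_cast at r1; rw [e] at r1
    exact_mod_cast r1
  set A : Fin 3 → ℤ := ((a : ℤ) + 1) • v0 + (b : ℤ) • v2 + n • u + (i : ℤ) • w with hA
  set B : Fin 3 → ℤ := (a : ℤ) • v0 + ((b : ℤ) + 1) • v2 with hB
  set N : ℤ → ℤ := fun r => ⌈(r : ℝ) * m / q⌉ with hN
  set E : ℤ → ℝ := fun r => N r - (r : ℝ) * m / q with hE
  have E0 : ∀ r, 0 ≤ E r := fun r => by
    simp only [hE, hN]; linarith [Int.le_ceil ((r : ℝ) * m / q)]
  have E1 : ∀ r, E r ≤ 1 := fun r => by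
    simp only [hE, hN]; linarith [Int.ceil_lt_add_one ((r : ℝ) * m / q)]
  set p : ℤ → Fin 3 → ℤ := fun r => B + r • g + N r • u with hp
  have hpR : ∀ r j, (p r j : ℝ) = a * v0 j + (b + 1) * v2 j + E r * u j + (r / q : ℝ) * w j := by
    intro r j
    simp only [hp, hB, hE, Pi.add_apply, Pi.smul_apply, smul_eq_mul]
    push_cast
    rw [hwR j]; field_simp; ring
  have pK : ∀ r : ℤ, 0 ≤ (r : ℝ) → (r : ℝ) ≤ q * (b + 1) → toR3 (p r) ∈ K := by
    intro r h h'
    refine hKm a (b + 1) (E r) (r / q) (by linarith) (E0 r) ((E1 r).trans haR) (by positivity) ?_ _ (hpR r)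
    rw [div_le_iff₀ hqR]; linarith
  have AK : toR3 A ∈ K := by
    refine hKm (a + 1) b n i (by linarith) n0R (by linarith) hiR0 hiR _ ?_
    intro j; simp [toR3, hA]
  have AuK : toR3 (A + u) ∈ K := by
    refine hKm (a + 1) b (n + 1) i (by linarith) (by linarith) (by linarith) hiR0 hiR _ ?_
    intro j; simp [toR3, hA]; ring
  have BK : ∀ i l : ℤ, 0 ≤ i → i ≤ a → 0 ≤ l → l ≤ ((b + 1 : ℕ) : ℤ) → toR3 (B + i • u + l • w) ∈ K := by
    intro i l a1 a2 a3 a4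
    refine hKm a (b + 1) i l (by linarith) (by exact_mod_cast a1) (by exact_mod_cast a2) (by exact_mod_cast a3) (by exact_mod_cast a4) _ ?_
    intro j; simp [toR3, hB]
  have hfc : f (toR3 (v2 - v0)) = f (toR3 v2) - f (toR3 v0) := by
    rw [← map_sub]; congr 1; ext j; simp [toR3]
  have fAB : |f (toR3 A) - f (toR3 B)| = 1 := by
    have eA : toR3 A = ((a : ℝ) + 1) • toR3 v0 + (b : ℝ) • toR3 v2 + (n : ℝ) • toR3 u + (i : ℝ) • toR3 w := by
      ext j; simp [toR3, hA]
    have eB : toR3 B = (a : ℝ) • toR3 v0 + ((b : ℝ) + 1) • toR3 v2 := by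
      ext j; simp [toR3, hB]
    rw [← fc, ← abs_neg (f (toR3 (v2 - v0))), hfc, eA, eB]
    congr 1
    simp [fu, fw]; ring
  have fAB' : |f (toR3 (A + u)) - f (toR3 B)| = 1 := by
    have eA : toR3 (A + u) = toR3 A + toR3 u := by ext j; simp [toR3]
    rw [eA, map_add, fu, add_zero]; exact fAB
  have dAB : D3 u w (A - B) ≠ 0 := by
    have : D3 u w (A - B) = - D3 u w (v2 - v0) := by simp [D3, hA, hB]; ring
    rw [this]; exact neg_ne_zero.2 hd
  have dAB' : D3 u w (A + u - B) ≠ 0 := by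
    have : D3 u w (A + u - B) = - D3 u w (v2 - v0) := by simp [D3, hA, hB]; ring
    rw [this]; exact neg_ne_zero.2 hd
  set ρ : ℝ := q * B1 - r with hρ
  set T : ℝ := (1 - ρ) * E r + ρ * E (r + 1) with hT
  have T0 : 0 ≤ T := add_nonneg (mul_nonneg (by linarith) (E0 r)) (mul_nonneg (by linarith) (E0 _))
  have T1 : T ≤ 1 := by
    have := E1 r
    have := E1 (r + 1)
    rw [hT]; nlinarith
  set S : ℝ := (1 - h) * (A0 - n) + h * (A1 - T) with hS
  have tauR : ∀ j, (1 - ρ) * (p r j : ℝ) + ρ * (p (r + 1) j : ℝ) = a * v0 j + (b + 1) * v2 j + T * u j + B1 * w j := by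
    intro j
    rw [hpR, hpR, hT, hρ]; push_cast
    field_simp; ring
  have hxx : ∀ j, x j = (1 - h) * A j + h * (B j + T * u j + B1 * w j) + S * u j := by
    intro j
    rw [hx j, hS, hA, hB]
    simp only [Pi.add_apply, Pi.smul_apply, smul_eq_mul]
    push_cast
    linear_combination (-(u j : ℝ)) * Ae - (w j : ℝ) * B1e
  clear_value S T
  by_cases c1 : S < 0
  · have hpos : 0 < h := by
      rcases h0.eq_or_lt with hz | hz
      · exfalso; rw [← hz] at hS; linarith
      · exact hz
    refine cov_cone K hK f hfint x u w A B fu fw fAB dAB a (b + 1) ha (by omega) AK BK h (T + S / h) B1 h0 h1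
      ?_ ?_ B10 (by exact_mod_cast B11) ?_
    · have : 0 ≤ (h * T + S) / h := div_nonneg (by
        have t1 := mul_nonneg (sub_nonneg.2 h1) (sub_nonneg.2 n2)
        have t2 := mul_nonneg h0 A10
        rw [hS]; linarith) h0
      rw [add_div, mul_div_cancel_left₀ _ hpos.ne'] at this; exact this
    · have : S / h ≤ 0 := div_nonpos_of_nonpos_of_nonneg c1.le h0
      linarith
    · intro j; rw [hxx j]; field_simp; ring
  · by_cases c2 : 1 - h < S
    · have hpos : 0 < h := by
        rcases h0.eq_or_lt with hz | hz
        · exfalso; rw [← hz] at hS c2; linarith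
        · exact hz
      refine cov_cone K hK f hfint x u w (A + u) B fu fw fAB' dAB' a (b + 1) ha (by omega) AuK BK h (T + (S - (1 - h)) / h) B1 h0 h1
        ?_ ?_ B10 (by exact_mod_cast B11) ?_
      · have : 0 ≤ (S - (1 - h)) / h := div_nonneg (by linarith) h0
        linarith
      · have : (h * T + (S - (1 - h))) / h ≤ a := by
          have t1 := mul_nonneg (sub_nonneg.2 h1) (sub_nonneg.2 n3)
          have t2 := mul_nonneg h0 (sub_nonneg.2 A11)
          rw [div_le_iff₀ hpos, hS]; linarith
        rw [add_div, mul_div_cancel_left₀ _ hpos.ne'] at this; exact this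
      · intro j; rw [hxx j]; simp only [Pi.add_apply]; push_cast; field_simp; ring
    · push Not at c1 c2
      refine ⟨![A, A + u, p r, p (r + 1)], ?_, ⟨![1 - h - S, S, h * (1 - ρ), h * ρ], ?_, ?_, ?_⟩, ?_⟩
      · intro k
        fin_cases k
        · exact AK
        · exact AuK
        · exact pK r r0R (by linarith)
        · exact pK (r + 1) (by push_cast; linarith) (by push_cast; linarith)
      · intro k
        fin_cases k
        · simp only [Fin.zero_eta, Matrix.cons_val]; linarith
        · exact c1
        · exact mul_nonneg h0 (by linarith)
        · exact mul_nonneg h0 (by linarith)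
      · simp [Fin.sum_univ_four]; ring
      · intro j
        rw [hxx j]
        simp only [Fin.sum_univ_four, Matrix.cons_val, Pi.add_apply]
        have e := tauR j
        have eB : (B j : ℝ) = a * v0 j + (b + 1) * v2 j := by simp [hB]
        push_cast
        rw [eB]
        linear_combination (-h) * e
      · have : D4 ![A, A + u, p r, p (r + 1)] = - D3 u g (v2 - v0) := by
          simp only [D4, D3, hp, hA, hB, Matrix.cons_val, Pi.add_apply, Pi.sub_apply, Pi.smul_apply, smul_eq_mul, hw 0, hw 1, hw 2]
          ring
        rw [this, abs_neg, hg]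


lemma D3_comb {R : Type*} [CommRing R] (a b c p q r : Fin 3 → R) :
    D3 (p 0 • a + p 1 • b + p 2 • c) (q 0 • a + q 1 • b + q 2 • c) (r 0 • a + r 1 • b + r 2 • c)
      = D3 p q r * D3 a b c := by
  simp [D3]; ring

lemma cov_uni (K : Set (Fin 3 → ℝ)) (v : Fin 4 → Fin 3 → ℤ) (hd : |D4 v| = 1) (k : ℕ)
    (hKm : ∀ t : Fin 4 → ℝ, (∀ i, 0 ≤ t i) → ∑ i, t i = k → ∀ y : Fin 3 → ℝ,
      (∀ j, y j = ∑ i, t i * (v i j : ℝ)) → y ∈ K) (hk : 1 ≤ k) (x : Fin 3 → ℝ)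
    (t : Fin 4 → ℝ) (t0 : ∀ i, 0 ≤ t i) (t1 : ∑ i, t i = k)
    (hx : ∀ j, x j = ∑ i, t i * (v i j : ℝ)) : Cov K x := by
  have key : ∀ (N : Fin 4 → Fin 3 → ℤ) (o : Fin 4 → ℝ),
      (∀ i, 0 ≤ N i 0 ∧ N i 0 ≤ N i 1 ∧ N i 1 ≤ N i 2 ∧ N i 2 ≤ k) → (∀ i, 0 ≤ o i) →
      ∑ i, o i = 1 → ∑ i, o i * (N i 0 : ℝ) = t 1 → ∑ i, o i * (N i 1 : ℝ) = t 1 + t 2 →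
      ∑ i, o i * (N i 2 : ℝ) = t 1 + t 2 + t 3 → |D4 N| = 1 → Cov K x := by
    intro N o hN o0 o1 e0 e1 e2 hD
    refine ⟨fun i => (k - N i 2) • v 0 + N i 0 • v 1 + (N i 1 - N i 0) • v 2 + (N i 2 - N i 1) • v 3,
      ?_, ⟨o, o0, o1, ?_⟩, ?_⟩
    · intro i
      obtain ⟨a, b, c, d⟩ := hN i
      have a' : (0 : ℝ) ≤ N i 0 := by exact_mod_cast a
      have b' : (N i 0 : ℝ) ≤ N i 1 := by exact_mod_cast b
      have c' : (N i 1 : ℝ) ≤ N i 2 := by exact_mod_cast c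
      have d' : (N i 2 : ℝ) ≤ k := by exact_mod_cast d
      refine hKm ![k - N i 2, N i 0, N i 1 - N i 0, N i 2 - N i 1] ?_ ?_ _ ?_
      · intro l; fin_cases l <;> simp <;> assumption
      · simp [Fin.sum_univ_four]
      · intro j; simp [Fin.sum_univ_four, toR3]
    · intro j
      rw [hx j]
      simp only [Fin.sum_univ_four, Pi.add_apply, Pi.smul_apply, smul_eq_mul] at *
      push_cast
      linear_combination (v 0 j : ℝ) * t1 - (v 0 j : ℝ) * k * o1 + (v 0 j - v 3 j : ℝ) * e2 + (v 2 j - v 1 j : ℝ) * e0 + (v 3 j - v 2 j : ℝ) * e1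
    · have : ∀ i, ((k - N i 2) • v 0 + N i 0 • v 1 + (N i 1 - N i 0) • v 2 + (N i 2 - N i 1) • v 3)
        - ((k - N 0 2) • v 0 + N 0 0 • v 1 + (N 0 1 - N 0 0) • v 2 + (N 0 2 - N 0 1) • v 3) =
          (N i - N 0) 0 • (v 1 - v 2) + (N i - N 0) 1 • (v 2 - v 3) + (N i - N 0) 2 • (v 3 - v 0) := by
        intro i; ext j; simp; ring
      simp only [D4] at hd hD ⊢
      rw [this, this, this, D3_comb, abs_mul, hD, one_mul, ← hd]
      congr 1
      simp [D3]; ring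
  clear hx hKm hd
  simp only [Fin.sum_univ_four] at t1 key
  have p0 := t0 0
  have p1 := t0 1
  have p2 := t0 2
  have p3 := t0 3
  have cell' : ∀ y y' : ℝ, 0 ≤ y → y ≤ y' → y' ≤ k →
      (min ⌊y⌋ ((k : ℤ) - 1)) ≤ min ⌊y'⌋ ((k : ℤ) - 1) := by
    intro y y' _ h _
    exact min_le_min (Int.floor_mono h) le_rfl
  have cell0 : ∀ y : ℝ, 0 ≤ y → y ≤ k → 0 ≤ min ⌊y⌋ ((k : ℤ) - 1) ∧ min ⌊y⌋ ((k : ℤ) - 1) + 1 ≤ k ∧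
      ((min ⌊y⌋ ((k : ℤ) - 1) : ℤ) : ℝ) ≤ y ∧ y ≤ (min ⌊y⌋ ((k : ℤ) - 1) : ℤ) + 1 := by
    intro y h h'
    refine ⟨le_min (Int.floor_nonneg.2 h) (by omega), by have := min_le_right ⌊y⌋ ((k : ℤ) - 1); omega, ?_, ?_⟩
    · exact le_trans (by exact_mod_cast min_le_left _ _) (Int.floor_le y)
    · rcases min_choice ⌊y⌋ ((k : ℤ) - 1) with h1 | h1 <;> rw [h1]
      · exact (Int.lt_floor_add_one y).le
      · push_cast; linarith
  have m12 := cell' (t 1) (t 1 + t 2) p1 (by linarith) (by linarith)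
  have m23 := cell' (t 1 + t 2) (t 1 + t 2 + t 3) (by linarith) (by linarith) (by linarith)
  obtain ⟨a1, b1, c1, d1⟩ := cell0 (t 1) p1 (by linarith)
  obtain ⟨a2, b2, c2, d2⟩ := cell0 (t 1 + t 2) (by linarith) (by linarith)
  obtain ⟨a3, b3, c3, d3⟩ := cell0 (t 1 + t 2 + t 3) (by linarith) (by linarith)
  clear cell' cell0
  generalize min ⌊t 1⌋ ((k : ℤ) - 1) = n1 at *
  generalize min ⌊t 1 + t 2⌋ ((k : ℤ) - 1) = n2 at *
  generalize min ⌊t 1 + t 2 + t 3⌋ ((k : ℤ) - 1) = n3 at *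
  have s12 : t 1 + t 2 - n2 < t 1 - n1 → n1 + 1 ≤ n2 := by
    intro h
    have : (n1 : ℝ) < n2 := by linarith
    exact_mod_cast this
  have s23 : t 1 + t 2 + t 3 - n3 < t 1 + t 2 - n2 → n2 + 1 ≤ n3 := by
    intro h
    have : (n2 : ℝ) < n3 := by linarith
    exact_mod_cast this
  obtain ⟨f1, hf1⟩ : ∃ f1, f1 = t 1 - n1 := ⟨_, rfl⟩
  obtain ⟨f2, hf2⟩ : ∃ f2, f2 = t 1 + t 2 - n2 := ⟨_, rfl⟩
  obtain ⟨f3, hf3⟩ : ∃ f3, f3 = t 1 + t 2 + t 3 - n3 := ⟨_, rfl⟩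
  have fin : ∀ (e1 e2 : Fin 3 → ℤ) (g1 g2 g3 : ℝ),
      (n1 + e1 0 ≤ n2 + e1 1 ∧ n2 + e1 1 ≤ n3 + e1 2) → (n1 + e2 0 ≤ n2 + e2 1 ∧ n2 + e2 1 ≤ n3 + e2 2) →
      (∀ i, 0 ≤ e1 i ∧ e1 i ≤ 1) → (∀ i, 0 ≤ e2 i ∧ e2 i ≤ 1) → g1 ≤ 1 → g2 ≤ g1 → g3 ≤ g2 → 0 ≤ g3 →
      (g1 - g2) * e1 0 + (g2 - g3) * e2 0 + g3 = f1 → (g1 - g2) * e1 1 + (g2 - g3) * e2 1 + g3 = f2 →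
      (g1 - g2) * e1 2 + (g2 - g3) * e2 2 + g3 = f3 → |D3 e1 e2 1| = 1 → Cov K x := by
    intro e1 e2 g1 g2 g3 h1 h2 h3 h4 q1 q2 q3 q4 r1 r2 r3 hD
    refine key ![![n1, n2, n3], ![n1 + e1 0, n2 + e1 1, n3 + e1 2], ![n1 + e2 0, n2 + e2 1, n3 + e2 2],
      ![n1 + 1, n2 + 1, n3 + 1]] ![1 - g1, g1 - g2, g2 - g3, g3] ?_ ?_ ?_ ?_ ?_ ?_ ?_
    · have := h3 0
      have := h3 2
      have := h4 0
      have := h4 2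
      intro i; fin_cases i <;> simp <;> omega
    · intro i; fin_cases i <;> simp <;> linarith
    · simp
    · simp; linarith
    · simp; linarith
    · simp; linarith
    · have e : D4 ![![n1, n2, n3], ![n1 + e1 0, n2 + e1 1, n3 + e1 2], ![n1 + e2 0, n2 + e2 1, n3 + e2 2],
          ![n1 + 1, n2 + 1, n3 + 1]] = D3 e1 e2 1 := by simp [D4, D3]
      rw [e, hD]
  have bnd : ∀ a b c : ℤ, (0 ≤ a ∧ a ≤ 1) → (0 ≤ b ∧ b ≤ 1) → (0 ≤ c ∧ c ≤ 1) →
      ∀ i, 0 ≤ (![a, b, c] : Fin 3 → ℤ) i ∧ (![a, b, c] : Fin 3 → ℤ) i ≤ 1 := by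
    intro a b c ha hb hc i; fin_cases i <;> simpa
  rw [← hf1, ← hf2] at s12
  rw [← hf2, ← hf3] at s23
  have F1 : 0 ≤ f1 ∧ f1 ≤ 1 := by constructor <;> linarith
  have F2 : 0 ≤ f2 ∧ f2 ≤ 1 := by constructor <;> linarith
  have F3 : 0 ≤ f3 ∧ f3 ≤ 1 := by constructor <;> linarith
  clear key
  rcases le_or_gt f1 f2 with h12 | h12 <;> rcases le_or_gt f2 f3 with h23 | h23
  · apply fin ![0, 0, 1] ![0, 1, 1] f3 f2 f1 <;> first | (apply bnd <;> norm_num) | (simp [D3]; done) | (simp; done) | (simp; omega) | linarith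
  · have := s23 h23
    rcases le_or_gt f1 f3 with h13 | h13
    · apply fin ![0, 1, 0] ![0, 1, 1] f2 f3 f1 <;> first | (apply bnd <;> norm_num) | (simp [D3]; done) | (simp; done) | (simp; omega) | linarith
    · apply fin ![0, 1, 0] ![1, 1, 0] f2 f1 f3 <;> first | (apply bnd <;> norm_num) | (simp [D3]; done) | (simp; done) | (simp; omega) | linarith
  · have := s12 h12
    rcases le_or_gt f1 f3 with h13 | h13
    · apply fin ![0, 0, 1] ![1, 0, 1] f3 f1 f2 <;> first | (apply bnd <;> norm_num) | (simp [D3]; done) | (simp; done) | (simp; omega) | linarith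
    · apply fin ![1, 0, 0] ![1, 0, 1] f1 f3 f2 <;> first | (apply bnd <;> norm_num) | (simp [D3]; done) | (simp; done) | (simp; omega) | linarith
  · have := s12 h12
    have := s23 h23
    apply fin ![1, 0, 0] ![1, 1, 0] f1 f2 f3 <;> first | (apply bnd <;> norm_num) | (simp [D3]; done) | (simp; done) | (simp; omega) | linarith

def lift4 (p : Fin 3 → ℝ) : Fin 4 → ℝ := ![1, p 0, p 1, p 2]

lemma D4_det4 (v : Fin 4 → Fin 3 → ℝ) : (Matrix.of fun i => lift4 (v i)).det = D4 v := by
  simp [Matrix.det_succ_row_zero, Fin.sum_univ_succ, lift4, D4, D3, Fin.succAbove]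
  ring

lemma D4_perm (v : Fin 4 → Fin 3 → ℤ) (s : Equiv.Perm (Fin 4)) : |D4 (v ∘ s)| = |D4 v| := by
  have h1 : |((D4 (v ∘ s) : ℤ) : ℝ)| = |((D4 v : ℤ) : ℝ)| := by
    rw [D4_cast, D4_cast, ← D4_det4, ← D4_det4]
    have := Matrix.det_permute s (Matrix.of fun i => lift4 (toR3 (v i)))
    have e : (Matrix.of fun i => lift4 (toR3 ((v ∘ s) i))) = (Matrix.of fun i => lift4 (toR3 (v i))).submatrix s id := rfl
    rw [e, this, abs_mul]
    rcases Int.units_eq_one_or (Equiv.Perm.sign s) with h | h <;> simp [h]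
  exact_mod_cast h1

lemma inTet_perm (v : Fin 4 → Fin 3 → ℤ) (s : Equiv.Perm (Fin 4)) (x : Fin 3 → ℝ) (h : InTet v x) :
    InTet (v ∘ s) x := by
  obtain ⟨t, t0, t1, t2⟩ := h
  refine ⟨t ∘ s, fun i => t0 _, ?_, fun j => ?_⟩
  · rw [← t1]; exact Equiv.sum_comp s t
  · rw [t2 j]; exact (Equiv.sum_comp s (fun i => t i * (v i j : ℝ))).symm

lemma exists_tet (S : Set (Fin 3 → ℤ)) (hS : affineSpan ℝ (toR3 '' S) = ⊤) (x : Fin 3 → ℝ)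
    (hx : x ∈ convexHull ℝ (toR3 '' S)) :
    ∃ v : Fin 4 → Fin 3 → ℤ, (∀ i, v i ∈ S) ∧ InTet v x ∧ D4 v ≠ 0 := by
  rw [convexHull_eq_union] at hx
  simp only [Set.mem_iUnion] at hx
  obtain ⟨s, hs, hai, hxs⟩ := hx
  have hli : LinearIndepOn ℝ lift4 (s : Set (Fin 3 → ℝ)) := by
    rw [LinearIndepOn, linearIndependent_iff']
    intro T g hg i hi
    rw [affineIndependent_iff] at hai
    have c0 := congrFun hg 0
    have c1 := congrFun hg 1
    have c2 := congrFun hg 2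
    have c3 := congrFun hg 3
    simp [lift4, Finset.sum_apply] at c0 c1 c2 c3
    refine hai T g c0 ?_ i hi
    ext j
    fin_cases j <;> simp [Finset.sum_apply] <;> assumption
  obtain ⟨b, hbt, hsb, hspan, hb⟩ := exists_linearIndepOn_extension hli hs
  set W := Submodule.span ℝ (lift4 '' b) with hW
  have hall : ∀ p : Fin 3 → ℝ, lift4 p ∈ W := by
    intro p
    have hp : p ∈ affineSpan ℝ (toR3 '' S) := by rw [hS]; trivial
    refine affineSpan_induction (p := fun p => lift4 p ∈ W) hp (fun y hy => hspan ⟨y, hy, rfl⟩) ?_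
    intro c u v w hu hv hw
    have : lift4 (c • (u -ᵥ v) +ᵥ w) = c • (lift4 u - lift4 v) + lift4 w := by
      ext i; fin_cases i <;> simp [lift4]
    rw [this]
    exact W.add_mem (W.smul_mem _ (W.sub_mem hu hv)) hw
  have htop : W = ⊤ := by
    rw [eq_top_iff]
    intro y _
    have : y = lift4 ![y 1, y 2, y 3] + (y 0 - 1) • lift4 0 := by
      ext i; fin_cases i <;> simp [lift4]
    rw [this]
    exact W.add_mem (hall _) (W.smul_mem _ (hall _))
  let B : Module.Basis b ℝ (Fin 4 → ℝ) := Module.Basis.mk (v := fun i : b => lift4 i) hb (by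
    rw [← htop, hW, Set.image_eq_range])
  haveI : Fintype b := FiniteDimensional.fintypeBasisIndex B
  have hcard : Fintype.card b = 4 := by
    rw [← Module.finrank_eq_card_basis B]; simp
  let e : Fin 4 ≃ b := (Fintype.equivFinOfCardEq hcard).symm
  have hex : ∀ i, ∃ z ∈ S, toR3 z = e i := fun i => hbt (e i).2
  choose v hvS hve using hex
  refine ⟨v, hvS, ?_, ?_⟩
  · have hx' : x ∈ convexHull ℝ b := convexHull_mono hsb hxs
    have hsub : convexHull ℝ b ⊆ {x | InTet v x} := by
      apply convexHull_min
      · intro y hy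
        refine ⟨Pi.single (e.symm ⟨y, hy⟩) 1, ?_, by simp, ?_⟩
        · intro i; by_cases h : i = e.symm ⟨y, hy⟩
          · subst h; simp
          · simp [h]
        · intro j
          have := hve (e.symm ⟨y, hy⟩)
          rw [Equiv.apply_symm_apply] at this
          have := congrFun this j
          simp [Pi.single_apply]
          exact this.symm
      · rintro y ⟨t, t0, t1, t2⟩ y' ⟨t', t0', t1', t2'⟩ a c ha hc hac
        refine ⟨fun i => a * t i + c * t' i, fun i => ?_, ?_, fun j => ?_⟩
        · exact add_nonneg (mul_nonneg ha (t0 i)) (mul_nonneg hc (t0' i))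
        · rw [Finset.sum_add_distrib, ← Finset.mul_sum, ← Finset.mul_sum, t1, t1']; linarith
        · simp only [Pi.add_apply, Pi.smul_apply, smul_eq_mul, t2 j, t2' j, Fin.sum_univ_four]; ring
    exact hsub hx'
  · have hl : LinearIndependent ℝ (fun i => lift4 (toR3 (v i))) := by
      have : (fun i => lift4 (toR3 (v i))) = (fun i : b => lift4 i) ∘ e := by
        ext i; simp [hve]
      rw [this]
      exact LinearIndependent.comp hb e e.injective
    have h2 : IsUnit (Matrix.of fun i => lift4 (toR3 (v i))) := Matrix.linearIndependent_rows_iff_isUnit.1 hl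
    rw [Matrix.isUnit_iff_isUnit_det, D4_det4, ← D4_cast] at h2
    have := h2.ne_zero
    exact_mod_cast this



lemma nonconst (f : (Fin 3 → ℝ) →ₗ[ℝ] ℝ) (z : Fin 3 → ℤ) (hz : f (toR3 z) = 1)
    (v : Fin 4 → Fin 3 → ℤ) (hd : D4 v ≠ 0) (h : ∀ i, f (toR3 (v i)) = f (toR3 (v 0))) : False := by
  have hd' : (D4 (fun i => toR3 (v i))) ≠ 0 := by
    rw [← D4_cast]; exact_mod_cast hd
  have hs : ∀ i, f (toR3 (v i) - toR3 (v 0)) = 0 := fun i => by rw [map_sub, h i, sub_self]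
  have h1 := hs 1
  have h2 := hs 2
  have h3 := hs 3
  unfold D4 at hd'
  set a := toR3 (v 1) - toR3 (v 0)
  set b := toR3 (v 2) - toR3 (v 0)
  set c := toR3 (v 3) - toR3 (v 0)
  set w := toR3 z
  have e : D3 a b c • w = D3 w b c • a + D3 a w c • b + D3 a b w • c := by
    ext j
    fin_cases j <;> simp [D3] <;> ring
  have := congrArg f e
  simp only [map_add, map_smul, h1, h2, h3, hz] at this
  simp at this
  exact hd' this

lemma pattern : ∀ b : Fin 4 → Bool, (∀ i, b i = b 0) ∨ ∃ s : Equiv.Perm (Fin 4),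
    (b (s 1) = b (s 0) ∧ b (s 2) = b (s 0) ∧ b (s 3) ≠ b (s 0)) ∨
    (b (s 1) = b (s 0) ∧ b (s 2) ≠ b (s 0) ∧ b (s 3) = b (s 2)) := by
  decide +kernel

lemma smul_mem_of (P : Set (Fin 3 → ℝ)) (hP : Convex ℝ P) (v : Fin 4 → Fin 3 → ℤ)
    (hv : ∀ i, toR3 (v i) ∈ P) (k : ℕ) (hk : 1 ≤ k) (t : Fin 4 → ℝ) (t0 : ∀ i, 0 ≤ t i)
    (t1 : ∑ i, t i = k) (y : Fin 3 → ℝ) (hy : ∀ j, y j = ∑ i, t i * (v i j : ℝ)) :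
    y ∈ (k : ℝ) • P := by
  have hk0 : (k : ℝ) ≠ 0 := by positivity
  have : (k : ℝ)⁻¹ • y ∈ P := by
    refine mem_of_comb hP v hv _ ⟨fun i => (k : ℝ)⁻¹ * t i, fun i => ?_, ?_, fun j => ?_⟩
    · have := t0 i; positivity
    · rw [← Finset.mul_sum, t1, inv_mul_cancel₀ hk0]
    · simp only [Pi.smul_apply, smul_eq_mul, hy j, Finset.mul_sum, mul_assoc]
  exact ⟨_, this, by simp [smul_smul, hk0]⟩

lemma cov_22 (P : Set (Fin 3 → ℝ)) (hP : Convex ℝ P) (f : (Fin 3 → ℝ) →ₗ[ℝ] ℝ)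
    (hfint : ∀ z : Fin 3 → ℤ, ∃ n : ℤ, f (toR3 z) = n) (y : Fin 3 → ℝ)
    (v : Fin 4 → Fin 3 → ℤ) (hm : IsMinTet (fun v => ∀ i, toR3 (v i) ∈ P) y v)
    (h1 : f (toR3 (v 1)) = f (toR3 (v 0))) (h3 : f (toR3 (v 3)) = f (toR3 (v 2)))
    (h2 : |f (toR3 (v 2)) - f (toR3 (v 0))| = 1) (k : ℕ) (hk : 2 ≤ k) :
    Cov ((k : ℝ) • P) ((k : ℝ) • y) := by
  obtain ⟨hv, ⟨t, t0, t1, hy⟩, hd, -⟩ := id hm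
  have hsub : ∀ a b : Fin 3 → ℤ, toR3 (a - b) = toR3 a - toR3 b := by
    intro a b; ext j; simp [toR3]
  have hprim : ∀ (p q : Fin 4), p ≠ q → ∀ (l : ℝ) (z : Fin 3 → ℤ), 0 ≤ l → l < 1 →
      (∀ j, (z j : ℝ) = l * ((v q - v p) j : ℤ)) → l = 0 := by
    intro p q hpq l z l0 l1 hz
    have hsum : ∀ g : Fin 4 → ℝ, ∑ i, (Pi.single p (1 - l) + Pi.single q l : Fin 4 → ℝ) i * g i
        = (1 - l) * g p + l * g q := by
      intro g
      simp [add_mul, Finset.sum_add_distrib, Pi.single_apply]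
    have c0 : ∀ i, 0 ≤ (Pi.single p (1 - l) + Pi.single q l : Fin 4 → ℝ) i := by
      intro i
      simp only [Pi.add_apply, Pi.single_apply]
      split_ifs <;> linarith
    have c1 : ∑ i, (Pi.single p (1 - l) + Pi.single q l : Fin 4 → ℝ) i = 1 := by
      have := hsum (fun _ => 1)
      simp only [mul_one] at this
      rw [this]; ring
    have c2 : ∀ j, (((v p + z) j : ℤ) : ℝ) =
        ∑ i, (Pi.single p (1 - l) + Pi.single q l : Fin 4 → ℝ) i * (v i j : ℝ) := by
      intro j
      rw [hsum (fun i => (v i j : ℝ))]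
      have := hz j
      push_cast [Pi.sub_apply, Pi.add_apply] at this ⊢
      rw [this]; ring
    obtain ⟨i, hi⟩ := empty_of_min _ y v hm _ (v p + z) c0 c1 c2 (by
      intro i _ i'
      by_cases h : i' = i
      · subst h
        rw [Function.update_self]
        exact mem_of_comb hP v hv _ ⟨_, c0, c1, c2⟩
      · rw [Function.update_of_ne h]; exact hv i')
    simp only [Pi.add_apply, Pi.single_apply] at hi
    split_ifs at hi with e1 e2 e2
    · exact absurd (e1.symm.trans e2) hpq
    · linarith
    · linarith
    · linarith
  have hp1 := hprim 0 1 (by decide)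
  have hp2 := hprim 2 3 (by decide)
  have T0 := t0 0
  have T1 := t0 1
  have T2 := t0 2
  have T3 := t0 3
  have hkR : (2 : ℝ) ≤ k := by exact_mod_cast hk
  simp only [Fin.sum_univ_four] at t1 hy
  have hd' : D3 (v 1 - v 0) (v 3 - v 2) (v 2 - v 0) ≠ 0 := by
    have : D3 (v 1 - v 0) (v 3 - v 2) (v 2 - v 0) = - D4 v := by
      simp [D4, D3]; ring
    rw [this]; exact neg_ne_zero.2 hd
  have hd'' : D3 (v 3 - v 2) (v 1 - v 0) (v 0 - v 2) ≠ 0 := by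
    have : D3 (v 3 - v 2) (v 1 - v 0) (v 0 - v 2) = - D4 v := by
      simp [D4, D3]; ring
    rw [this]; exact neg_ne_zero.2 hd
  have fu : f (toR3 (v 1 - v 0)) = 0 := by rw [hsub, map_sub, h1, sub_self]
  have fw : f (toR3 (v 3 - v 2)) = 0 := by rw [hsub, map_sub, h3, sub_self]
  have fc : |f (toR3 (v 2 - v 0))| = 1 := by rw [hsub, map_sub, h2]
  have fc' : |f (toR3 (v 0 - v 2))| = 1 := by rw [hsub, map_sub, abs_sub_comm, h2]
  have hKm : ∀ s0 s2 α β : ℝ, s0 + s2 = k → 0 ≤ α → α ≤ s0 → 0 ≤ β → β ≤ s2 → ∀ y : Fin 3 → ℝ,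
      (∀ j, y j = s0 * v 0 j + s2 * v 2 j + α * (v 1 - v 0) j + β * (v 3 - v 2) j) →
      y ∈ (k : ℝ) • P := by
    intro s0 s2 α β e a0 a1 b0 b1 y hy
    refine smul_mem_of P hP v hv k (by omega) ![s0 - α, α, s2 - β, β] ?_ ?_ y ?_
    · intro i; fin_cases i <;> simp <;> assumption
    · simp [Fin.sum_univ_four]; linarith
    · intro j
      rw [hy j]
      simp [Fin.sum_univ_four]; ring
  have hKm' : ∀ s0 s2 α β : ℝ, s0 + s2 = k → 0 ≤ α → α ≤ s0 → 0 ≤ β → β ≤ s2 → ∀ y : Fin 3 → ℝ,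
      (∀ j, y j = s0 * v 2 j + s2 * v 0 j + α * (v 3 - v 2) j + β * (v 1 - v 0) j) →
      y ∈ (k : ℝ) • P := by
    intro s0 s2 α β e a0 a1 b0 b1 y hy
    refine hKm s2 s0 β α (by linarith) b0 b1 a0 a1 y ?_
    intro j; rw [hy j]; ring
  have hs0 : 0 ≤ (k : ℝ) * (t 2 + t 3) := by positivity
  have hs1 : (k : ℝ) * (t 2 + t 3) ≤ k := by nlinarith
  obtain ⟨b, hb0, hb1, hb2, hb3⟩ := cell k (by omega) ((k : ℝ) * (t 2 + t 3)) hs0 hs1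
  lift b to ℕ using hb0
  obtain ⟨a, ha⟩ : ∃ a : ℕ, a + b + 1 = k := ⟨k - 1 - b, by omega⟩
  have haR : (a : ℝ) + b + 1 = k := by exact_mod_cast ha
  obtain ⟨h, hh⟩ : ∃ h, h = (k : ℝ) * (t 2 + t 3) - b := ⟨_, rfl⟩
  push_cast at hb2 hb3
  have A0 : 0 ≤ (k : ℝ) * t 0 := by positivity
  have A1 : 0 ≤ (k : ℝ) * t 1 := by positivity
  have A2 : 0 ≤ (k : ℝ) * t 2 := by positivity
  have A3 : 0 ≤ (k : ℝ) * t 3 := by positivity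
  have As : (k : ℝ) * t 0 + k * t 1 + k * t 2 + k * t 3 = k := by
    rw [← mul_add, ← mul_add, ← mul_add, t1, mul_one]
  have s0e : (a : ℝ) + 1 - h = k * t 0 + k * t 1 := by rw [hh]; linarith
  have s2e : (b : ℝ) + h = k * t 2 + k * t 3 := by rw [hh]; ring
  have opt1 : 1 ≤ a → (b = 0 ∨ 1 ≤ h * ((b : ℝ) + 2)) → Cov ((k : ℝ) • P) ((k : ℝ) • y) := by
    intro ha1 hbb
    refine cov_B _ (hP.smul _) f hfint _ (v 0) (v 1 - v 0) (v 2) (v 3 - v 2) fu fw fc hd' hp1 k a b ha1 ha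
      hKm h (k * t 1) (k * t 3) (by linarith) (by linarith) A1 (by linarith) A3 (by linarith) hbb ?_
    intro j
    rw [s0e, s2e, Pi.smul_apply, hy j, smul_eq_mul]
    push_cast [Pi.sub_apply]; ring
  have opt2 : 1 ≤ b → (a = 0 ∨ 1 ≤ (1 - h) * ((a : ℝ) + 2)) → Cov ((k : ℝ) • P) ((k : ℝ) • y) := by
    intro ha1 hbb
    refine cov_B _ (hP.smul _) f hfint _ (v 2) (v 3 - v 2) (v 0) (v 1 - v 0) fw fu fc' hd'' hp2 k b a ha1
      (by omega)
      hKm' (1 - h) (k * t 3) (k * t 1) (by linarith) (by linarith) A3 (by linarith) A1 (by linarith) hbb ?_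
    intro j
    have e1 : (b : ℝ) + 1 - (1 - h) = k * t 2 + k * t 3 := by linarith
    have e2 : (a : ℝ) + (1 - h) = k * t 0 + k * t 1 := by linarith
    rw [e1, e2, Pi.smul_apply, hy j, smul_eq_mul]
    push_cast [Pi.sub_apply]; ring
  rcases Nat.eq_zero_or_pos b with hb | hb
  · exact opt1 (by omega) (Or.inl hb)
  rcases Nat.eq_zero_or_pos a with ha' | ha'
  · exact opt2 hb (Or.inl ha')
  rcases le_total (1 / 2) h with hh' | hh'
  · refine opt1 ha' (Or.inr ?_)
    have : (0 : ℝ) ≤ b := by positivity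
    nlinarith
  · refine opt2 hb (Or.inr ?_)
    have : (0 : ℝ) ≤ a := by positivity
    nlinarith

lemma cov_main (V : Finset (Fin 3 → ℤ)) (P : Set (Fin 3 → ℝ))
    (hP : P = convexHull ℝ (toR3 '' ↑V))
    (hdim : affineSpan ℝ P = ⊤)
    (f : (Fin 3 → ℝ) →ₗ[ℝ] ℝ)
    (hfint : ∀ z : Fin 3 → ℤ, ∃ n : ℤ, f (toR3 z) = n)
    (hfsurj : ∀ n : ℤ, ∃ z : Fin 3 → ℤ, f (toR3 z) = n)
    (hwidth : ∀ x ∈ P, f x ∈ Set.Icc (0:ℝ) 1)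
    (k : ℕ) (hk : 2 ≤ k) (y : Fin 3 → ℝ) (hy : y ∈ P) : Cov ((k : ℝ) • P) ((k : ℝ) • y) := by
  have hconv : Convex ℝ P := by rw [hP]; exact convex_convexHull ℝ _
  have hS : affineSpan ℝ (toR3 '' (V : Set (Fin 3 → ℤ))) = ⊤ := by
    rw [← affineSpan_convexHull, ← hP, hdim]
  obtain ⟨v₁, hv₁, ht₁, hd₁⟩ := exists_tet (V : Set (Fin 3 → ℤ)) hS y (by rw [← hP]; exact hy)
  obtain ⟨v, hm⟩ := exists_min (fun v => ∀ i, toR3 (v i) ∈ P) y v₁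
    (fun i => by rw [hP]; exact subset_convexHull ℝ _ ⟨_, hv₁ i, rfl⟩) ht₁ hd₁
  obtain ⟨z, hz⟩ := hfsurj 1
  rw [Int.cast_one] at hz
  have hmp : ∀ s : Equiv.Perm (Fin 4), IsMinTet (fun v => ∀ i, toR3 (v i) ∈ P) y (v ∘ s) := by
    intro s
    obtain ⟨q1, q2, q3, q4⟩ := hm
    refine ⟨fun i => q1 (s i), inTet_perm v s y q2, ?_, fun v' a b c => ?_⟩
    · rw [← abs_pos, D4_perm, abs_pos]; exact q3
    · rw [D4_perm]; exact q4 v' a b c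
  have h01 : ∀ i, f (toR3 (v i)) = 0 ∨ f (toR3 (v i)) = 1 := by
    intro i
    obtain ⟨n, hn⟩ := hfint (v i)
    have h := hwidth _ (hm.1 i)
    rw [hn] at h ⊢
    obtain ⟨ha, hb⟩ := h
    have ha' : 0 ≤ n := by exact_mod_cast ha
    have hb' : n ≤ 1 := by exact_mod_cast hb
    have : n = 0 ∨ n = 1 := by omega
    rcases this with rfl | rfl <;> simp
  classical
  let b : Fin 4 → Bool := fun i => decide (f (toR3 (v i)) = 1)
  have beq : ∀ i j, b i = b j → f (toR3 (v i)) = f (toR3 (v j)) := by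
    intro i j h
    rcases h01 i with hi | hi <;> rcases h01 j with hj | hj <;> simp [b, hi, hj] at h ⊢
  have bne : ∀ i j, b i ≠ b j → |f (toR3 (v i)) - f (toR3 (v j))| = 1 := by
    intro i j h
    rcases h01 i with hi | hi <;> rcases h01 j with hj | hj <;> simp [b, hi, hj] at h ⊢
  rcases pattern b with hc | ⟨s, ⟨p1, p2, p3⟩ | ⟨p1, p2, p3⟩⟩
  · exact (nonconst f z hz v hm.2.2.1 (fun i => beq _ _ (hc i))).elim
  · have hms := hmp s
    obtain ⟨v', hv', ⟨t, t0, t1, t2⟩, hD⟩ := cov_13 P hconv f hfint y (v ∘ s) hms.1 hms.2.2.1 hms.2.1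
      (beq _ _ p1) (beq _ _ p2) (bne _ _ p3)
    refine cov_uni _ v' hD k (fun t t0 t1 y hy => smul_mem_of P hconv v' hv' k (by omega) t t0 t1 y hy)
      (by omega) _ (fun i => k * t i) (fun i => ?_) ?_ (fun j => ?_)
    · have := t0 i; positivity
    · rw [← Finset.mul_sum, t1, mul_one]
    · simp only [Pi.smul_apply, smul_eq_mul, t2 j, Finset.mul_sum, mul_assoc]
  · exact cov_22 P hconv f hfint y (v ∘ s) (hmp s) (beq _ _ p1) (beq _ _ p3) (bne _ _ p2) k hk

/-- Let `P` be a lattice 3-polytope of width `1`: there is a linear functional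
`f` which is integer-valued and surjective onto `ℤ` on the lattice (i.e. a
surjective `ℤ`-linear functional `ℤ³ → ℤ` extended to `ℝ³`) with
`f(P) ⊆ [0,1]`.  Then every integer dilation `kP`, `k ≥ 2`, has a unimodular
cover. -/
theorem width_one_dilation_has_unimodular_cover
    (V : Finset (Fin 3 → ℤ)) (P : Set (Fin 3 → ℝ))
    (hP : P = convexHull ℝ (toR3 '' ↑V))
    (hdim : affineSpan ℝ P = ⊤)
    (f : (Fin 3 → ℝ) →ₗ[ℝ] ℝ)
    (hfint : ∀ z : Fin 3 → ℤ, ∃ n : ℤ, f (toR3 z) = n)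
    (hfsurj : ∀ n : ℤ, ∃ z : Fin 3 → ℤ, f (toR3 z) = n)
    (hwidth : ∀ x ∈ P, f x ∈ Set.Icc (0:ℝ) 1)
    (k : ℕ) (hk : 2 ≤ k) :
    HasUnimodularCover ((k : ℝ) • P) := by
  have hconv : Convex ℝ P := by rw [hP]; exact convex_convexHull ℝ _
  refine cover_of_cov _ (hconv.smul _) ?_
  rintro x ⟨y, hy, rfl⟩
  exact cov_main V P hP hdim f hfint hfsurj hwidth k hk y hy
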